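/- If (V, ω) is a simple VOA of strong CFT type, then the group Aut V of vertex algebra automorphisms acts transitively on the set CV_sCFT of conformal vectors of strong CFT type: for every a ∈ CV_sCFT there exists f ∈ Aut V with f(ω) = a. Equivalently, a simple vertex algebra admits at most one self-dual (strong CFT type) VOA structure up to isomorphism. -/

import Mathlib

/-!
Common framework: vertex algebras, ℤ-graded (conformal) vertex algebras,
conformal vectors, automorphism groups, following Moriwaki,
"On classification of conformal vectors in vertex operator algebra and
the vertex algebra automorphism group".
-/

noncomputable section

open scoped BigOperators

/-- The generalized binomial coefficient `binom(m, i)` for `m : ℤ`, valued in a field `K`. -/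
def zBinom (K : Type*) [Field K] (m : ℤ) (i : ℕ) : K :=
  (∏ j ∈ Finset.range i, ((m : K) - (j : K))) / (Nat.factorial i : K)

/-- A vertex algebra over a field `K`: a `K`-vector space `V` equipped with bilinear
`n`-th products `a(n)b` (`n : ℤ`) and a vacuum vector `𝟙`, subject to the truncation
condition, the vacuum and creation axioms, and the Borcherds identity. -/
structure VA (K V : Type*) [Field K] [AddCommGroup V] [Module K V] where
  /-- the `n`-th product `a(n)b`, bilinear in `a` and `b` -/
  ncoef : ℤ → V →ₗ[K] V →ₗ[K] V
  /-- the vacuum vector `𝟙` -/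
  vac : V
  /-- truncation: `a(n)b = 0` for `n` sufficiently large -/
  trunc : ∀ a b : V, ∃ N : ℤ, ∀ n : ℤ, N ≤ n → ncoef n a b = 0
  /-- the vacuum axiom `Y(𝟙, z) = id`, i.e. `𝟙(n)a = δ_{n,-1} a` -/
  vac_ncoef : ∀ (n : ℤ) (a : V), ncoef n vac a = if n = -1 then a else 0
  /-- creation: `a(-1)𝟙 = a` -/
  ncoef_vac : ∀ a : V, ncoef (-1) a vac = a
  /-- creation: `a(n)𝟙 = 0` for `n ≥ 0` -/
  ncoef_vac_zero : ∀ n : ℤ, 0 ≤ n → ∀ a : V, ncoef n a vac = 0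
  /-- the Borcherds identity -/
  borcherds : ∀ (a b c : V) (p q m : ℤ),
    (∑ᶠ i : ℕ, zBinom K m i •
        ncoef (m + q - (i : ℤ)) (ncoef (p + (i : ℤ)) a b) c)
      = ∑ᶠ i : ℕ, ((-1 : K) ^ i * zBinom K p i) •
          (ncoef (m + p - (i : ℤ)) a (ncoef (q + (i : ℤ)) b c)
            - ((p.negOnePow : ℤ) : K) •
                ncoef (p + q - (i : ℤ)) b (ncoef (m + (i : ℤ)) a c))

namespace VA

variable {K V : Type*} [Field K] [AddCommGroup V] [Module K V]

/-- The translation operator `T a = a(-2)𝟙`. -/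
def T (A : VA K V) : V →ₗ[K] V := (A.ncoef (-2)).flip A.vac

/-- The eigenspace `V_n^a = {v ∈ V | a(1)v = n v}` of `a(1)`. -/
def eig (A : VA K V) (a : V) (n : ℤ) : Submodule K V :=
  LinearMap.ker (A.ncoef 1 a - (n : K) • (LinearMap.id : V →ₗ[K] V))

/-- `a` is a conformal vector: `a(1)a = 2a`, `a(3)a ∈ K𝟙`, `a(2)a = 0`, `a(n)a = 0`
for `n ≥ 4`, `a(0) = T`, and `a(1)` is semisimple with integer eigenvalues
(`V = ⊕_{n ∈ ℤ} V_n^a`). -/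
def IsConformal (A : VA K V) (a : V) : Prop :=
  A.ncoef 1 a a = (2 : K) • a ∧
  (∃ c : K, A.ncoef 3 a a = c • A.vac) ∧
  A.ncoef 2 a a = 0 ∧
  (∀ n : ℤ, 4 ≤ n → A.ncoef n a a = 0) ∧
  A.ncoef 0 a = A.T ∧
  DirectSum.IsInternal (A.eig a)

/-- `a` is a conformal vector of CFT type: `(V, a)` is a VOA of CFT type, i.e.
`V = ⊕_{n ∈ ℕ} V_n^a` with finite-dimensional pieces and `V_0^a = K𝟙`. -/
def IsConformalCFT (A : VA K V) (a : V) : Prop :=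
  A.IsConformal a ∧
  (∀ n : ℤ, n < 0 → A.eig a n = ⊥) ∧
  (∀ n : ℤ, FiniteDimensional K (A.eig a n)) ∧
  A.eig a 0 = Submodule.span K {A.vac}

/-- `a` is a conformal vector of strong CFT type: of CFT type and `a(2)V_1^a = 0`
(i.e. `L^a(1) V_1^a = 0`). -/
def IsConformalSCFT (A : VA K V) (a : V) : Prop :=
  A.IsConformalCFT a ∧ ∀ v ∈ A.eig a 1, A.ncoef 2 a v = 0

/-- A vertex algebra homomorphism: a linear map preserving all products and the vacuum. -/
structure IsVAHom (A : VA K V) (f : V → V) : Prop where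
  map_add : ∀ a b : V, f (a + b) = f a + f b
  map_smul : ∀ (c : K) (a : V), f (c • a) = c • f a
  map_ncoef : ∀ (n : ℤ) (a b : V), f (A.ncoef n a b) = A.ncoef n (f a) (f b)
  map_vac : f A.vac = A.vac

/-- A vertex algebra automorphism: a bijective vertex algebra homomorphism. -/
def IsVAAut (A : VA K V) (f : V → V) : Prop :=
  A.IsVAHom f ∧ Function.Bijective f

/-- A (two-sided) ideal of a vertex algebra. -/
def IsIdeal (A : VA K V) (I : Submodule K V) : Prop :=
  ∀ (n : ℤ) (a : V), ∀ b ∈ I, A.ncoef n a b ∈ I ∧ A.ncoef n b a ∈ I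

/-- A vertex algebra is simple if it has no ideals other than `0` and itself. -/
def IsSimple (A : VA K V) : Prop :=
  ∀ I : Submodule K V, A.IsIdeal I → I = ⊥ ∨ I = ⊤

end VA

/-- The exponential `exp f = Σ_{n≥0} f^n / n!` of an endomorphism, as a function
(meaningful for locally nilpotent `f`). -/
def expOp {K V : Type*} [Field K] [AddCommGroup V] [Module K V]
    (f : V →ₗ[K] V) (v : V) : V :=
  ∑ᶠ n : ℕ, (Nat.factorial n : K)⁻¹ • (f ^ n) v

/-- A ℤ-grading on a vertex algebra, making it a ℤ-graded vertex algebra: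
`V = ⊕_{n ∈ ℤ} V_n`, `V_n(k)V_m ⊆ V_{n+m-k-1}` and `𝟙 ∈ V_0`. -/
structure GradedVA {K V : Type*} [Field K] [AddCommGroup V] [Module K V] (A : VA K V) where
  /-- the grading subspaces `V_n` -/
  gr : ℤ → Submodule K V
  /-- `V = ⊕_{n ∈ ℤ} V_n` -/
  decomp : DirectSum.Decomposition gr
  /-- `𝟙 ∈ V_0` -/
  vac_mem : A.vac ∈ gr 0
  /-- `V_n(k)V_m ⊆ V_{n+m-k-1}` -/
  ncoef_mem : ∀ (n m k : ℤ), ∀ a ∈ gr n, ∀ b ∈ gr m, A.ncoef k a b ∈ gr (n + m - k - 1)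

namespace GradedVA

variable {K V : Type*} [Field K] [AddCommGroup V] [Module K V] {A : VA K V}

/-- The canonical projection `pr_n : V → V_n`. -/
def pr (G : GradedVA A) (n : ℤ) (v : V) : V :=
  letI := G.decomp
  (DirectSum.decompose G.gr v n : V)

/-- `V_{≥n} = ⊕_{i ≥ n} V_i`. -/
def ge (G : GradedVA A) (n : ℤ) : Submodule K V := ⨆ i ≥ n, G.gr i

/-- `V_{≤n} = ⊕_{i ≤ n} V_i`. -/
def le (G : GradedVA A) (n : ℤ) : Submodule K V := ⨆ i ≤ n, G.gr i

/-- `J_1(V) = {a ∈ V_1 | a(0) = 0}`. -/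
def J1 (G : GradedVA A) : Set V :=
  {a : V | a ∈ G.gr 1 ∧ A.ncoef 0 a = 0}

/-- `Aut⁺V`: automorphisms `f` with `f(V_n) ⊆ V_{≥n}` and `pr_n ∘ f|_{V_n} = id`. -/
def AutPlus (G : GradedVA A) (f : V → V) : Prop :=
  A.IsVAAut f ∧ ∀ n : ℤ, ∀ v ∈ G.gr n, f v ∈ G.ge n ∧ G.pr n (f v) = v

/-- `Aut⁻V`: automorphisms `f` with `f(V_n) ⊆ ⊕_{k ≤ n} V_k` and `pr_n ∘ f|_{V_n} = id`. -/
def AutMinus (G : GradedVA A) (f : V → V) : Prop :=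
  A.IsVAAut f ∧ ∀ n : ℤ, ∀ v ∈ G.gr n, f v ∈ G.le n ∧ G.pr n (f v) = v

/-- `Aut⁰V`: automorphisms `f` with `f(V_n) ⊆ V_n`. -/
def AutZero (G : GradedVA A) (f : V → V) : Prop :=
  A.IsVAAut f ∧ ∀ n : ℤ, ∀ v ∈ G.gr n, f v ∈ G.gr n

end GradedVA

/-- A ℤ-graded conformal vertex algebra: a ℤ-graded vertex algebra with a conformal
vector `ω ∈ V_2` whose modes `L(n) = ω(n+1)` satisfy the Virasoro relations, with
`L(0)v = n v` for `v ∈ V_n` and `L(-1) = T`. -/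
structure ConfGVA {K V : Type*} [Field K] [AddCommGroup V] [Module K V] (A : VA K V)
    extends GradedVA A where
  /-- the conformal vector -/
  ω : V
  ω_mem : ω ∈ gr 2
  /-- the Virasoro relations `[L(n), L(m)] = (n-m)L(n+m) + δ_{n+m,0}((n³-n)/12)c` -/
  virasoro : ∃ c : K, ∀ n m : ℤ,
    A.ncoef (n + 1) ω ∘ₗ A.ncoef (m + 1) ω - A.ncoef (m + 1) ω ∘ₗ A.ncoef (n + 1) ω
      = ((n : K) - (m : K)) • A.ncoef (n + m + 1) ω
        + (if n + m = 0 then ((n : K) ^ 3 - (n : K)) / 12 * c else 0)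
            • (LinearMap.id : V →ₗ[K] V)
  /-- `L(0) v = n v` for `v ∈ V_n` -/
  L0_grading : ∀ n : ℤ, ∀ v ∈ gr n, A.ncoef 1 ω v = (n : K) • v
  /-- `L(-1) = T` -/
  Lneg1_eq_T : A.ncoef 0 ω = A.T

namespace ConfGVA

variable {K V : Type*} [Field K] [AddCommGroup V] [Module K V] {A : VA K V}

abbrev pr (C : ConfGVA A) : ℤ → V → V := C.toGradedVA.pr
abbrev ge (C : ConfGVA A) : ℤ → Submodule K V := C.toGradedVA.ge
abbrev le (C : ConfGVA A) : ℤ → Submodule K V := C.toGradedVA.le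
abbrev J1 (C : ConfGVA A) : Set V := C.toGradedVA.J1
abbrev AutPlus (C : ConfGVA A) : (V → V) → Prop := C.toGradedVA.AutPlus
abbrev AutMinus (C : ConfGVA A) : (V → V) → Prop := C.toGradedVA.AutMinus
abbrev AutZero (C : ConfGVA A) : (V → V) → Prop := C.toGradedVA.AutZero

/-- `Aut_ω V`: the VOA automorphisms, i.e. the stabilizer of `ω` in `Aut V`. -/
def AutOmega (C : ConfGVA A) (f : V → V) : Prop :=
  A.IsVAAut f ∧ f C.ω = C.ω

/-- An invariant bilinear form on `(V, ω)`:
`(a(n)b, c) = (-1)^d Σ_{j≥0} (1/j!) (b, (L(1)^j a)(2d-n-2-j) c)` for `a ∈ V_d`, which is the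
coefficient form of `(Y(a,z)b, c) = (b, Y(e^{zL(1)}(-z^{-2})^{L(0)} a, z^{-1}) c)`. -/
def IsInvForm (C : ConfGVA A) (B : V →ₗ[K] V →ₗ[K] K) : Prop :=
  ∀ d : ℤ, ∀ a ∈ C.gr d, ∀ (b c : V) (n : ℤ),
    B (A.ncoef n a b) c
      = ((d.negOnePow : ℤ) : K) *
          ∑ᶠ j : ℕ, (Nat.factorial j : K)⁻¹ *
            B b (A.ncoef (2 * d - n - 2 - (j : ℤ)) ((A.ncoef 2 C.ω ^ j) a) c)

end ConfGVA

/-- A VOA of CFT type: a ℤ-graded conformal vertex algebra with `V = ⊕_{n ∈ ℕ} V_n`,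
`dim V_n < ∞`, and `V_0 = K𝟙`. -/
structure VOACFT {K V : Type*} [Field K] [AddCommGroup V] [Module K V] (A : VA K V)
    extends ConfGVA A where
  gr_neg : ∀ n : ℤ, n < 0 → gr n = ⊥
  gr_fd : ∀ n : ℤ, FiniteDimensional K (gr n)
  gr_zero : gr 0 = Submodule.span K {A.vac}

namespace VOACFT

variable {K V : Type*} [Field K] [AddCommGroup V] [Module K V] {A : VA K V}

abbrev pr (W : VOACFT A) : ℤ → V → V := W.toConfGVA.pr
abbrev ge (W : VOACFT A) : ℤ → Submodule K V := W.toConfGVA.ge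
abbrev le (W : VOACFT A) : ℤ → Submodule K V := W.toConfGVA.le
abbrev J1 (W : VOACFT A) : Set V := W.toConfGVA.J1
abbrev AutPlus (W : VOACFT A) : (V → V) → Prop := W.toConfGVA.AutPlus
abbrev AutMinus (W : VOACFT A) : (V → V) → Prop := W.toConfGVA.AutMinus
abbrev AutZero (W : VOACFT A) : (V → V) → Prop := W.toConfGVA.AutZero
abbrev AutOmega (W : VOACFT A) : (V → V) → Prop := W.toConfGVA.AutOmega
abbrev IsInvForm (W : VOACFT A) : (V →ₗ[K] V →ₗ[K] K) → Prop := W.toConfGVA.IsInvForm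

end VOACFT

/-- A VOA of strong CFT type: a VOA of CFT type with `L(1)V_1 = 0`. -/
structure VOAsCFT {K V : Type*} [Field K] [AddCommGroup V] [Module K V] (A : VA K V)
    extends VOACFT A where
  L1_V1 : ∀ v ∈ gr 1, A.ncoef 2 ω v = 0

namespace VOAsCFT

variable {K V : Type*} [Field K] [AddCommGroup V] [Module K V] {A : VA K V}

abbrev pr (W : VOAsCFT A) : ℤ → V → V := W.toVOACFT.pr
abbrev ge (W : VOAsCFT A) : ℤ → Submodule K V := W.toVOACFT.ge
abbrev le (W : VOAsCFT A) : ℤ → Submodule K V := W.toVOACFT.le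
abbrev J1 (W : VOAsCFT A) : Set V := W.toVOACFT.J1
abbrev AutPlus (W : VOAsCFT A) : (V → V) → Prop := W.toVOACFT.AutPlus
abbrev AutMinus (W : VOAsCFT A) : (V → V) → Prop := W.toVOACFT.AutMinus
abbrev AutZero (W : VOAsCFT A) : (V → V) → Prop := W.toVOACFT.AutZero
abbrev AutOmega (W : VOAsCFT A) : (V → V) → Prop := W.toVOACFT.AutOmega
abbrev IsInvForm (W : VOAsCFT A) : (V →ₗ[K] V →ₗ[K] K) → Prop := W.toVOACFT.IsInvForm

end VOAsCFT

end

theorem zBinom_zero_right {K : Type*} [Field K] (m : ℤ) : zBinom K m 0 = 1 := by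
  simp [zBinom]

theorem zBinom_natCast_eq_zero_of_lt {K : Type*} [Field K] {m i : ℕ} (h : m < i) :
    zBinom K (m : ℤ) i = 0 := by
  unfold zBinom
  rw [Finset.prod_eq_zero (Finset.mem_range.mpr h) (by simp), zero_div]

theorem zBinom_neg_one {K : Type*} [Field K] [CharZero K] (i : ℕ) :
    zBinom K (-1) i = (-1) ^ i := by
  unfold zBinom
  rw [div_eq_iff (by exact_mod_cast i.factorial_ne_zero)]
  induction i with
  | zero => simp
  | succ n ih =>
    rw [Finset.prod_range_succ, ih, Nat.factorial_succ]
    push_cast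
    ring

theorem zBinom_neg_two {K : Type*} [Field K] [CharZero K] (i : ℕ) :
    zBinom K (-2) i = (-1) ^ i * ((i : K) + 1) := by
  unfold zBinom
  rw [div_eq_iff (by exact_mod_cast i.factorial_ne_zero)]
  induction i with
  | zero => simp
  | succ n ih =>
    rw [Finset.prod_range_succ, ih, Nat.factorial_succ]
    push_cast
    ring

theorem neg_one_pow_mul_self_eq_one {K : Type*} [Field K] (i : ℕ) :
    (-1 : K) ^ i * (-1) ^ i = 1 := by
  rw [← mul_pow]
  simp

namespace VA

section Identities

variable {K V : Type*} [Field K] [AddCommGroup V] [Module K V] (A : VA K V)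

theorem T_vac : A.T A.vac = 0 := by
  change A.ncoef (-2) A.vac A.vac = 0
  rw [A.vac_ncoef, if_neg (by norm_num)]

theorem commutator_formula (m : ℕ) (q : ℤ) (a b c : V) :
    A.ncoef m a (A.ncoef q b c) - A.ncoef q b (A.ncoef m a c)
      = ∑ i ∈ Finset.range (m + 1),
          zBinom K m i • A.ncoef (m + q - i) (A.ncoef i a b) c := by
  have h := A.borcherds a b c 0 q m
  rw [finsum_eq_single (fun i : ℕ => ((-1 : K) ^ i * zBinom K 0 i) • _) 0,
    finsum_eq_sum_of_support_subset (s := Finset.range (m + 1))] at h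
  · simpa [zBinom_zero_right] using h.symm
  · intro i hi
    by_contra hmem
    refine hi ?_
    have hlt : m < i := by simpa using hmem
    simp [zBinom_natCast_eq_zero_of_lt hlt]
  · intro i hi
    have h0 : zBinom K ((0 : ℕ) : ℤ) i = 0 :=
      zBinom_natCast_eq_zero_of_lt (Nat.pos_of_ne_zero hi)
    rw [Nat.cast_zero] at h0
    simp [h0]

theorem ncoef_zero_ncoef (q : ℤ) (a b c : V) :
    A.ncoef 0 a (A.ncoef q b c) = A.ncoef q b (A.ncoef 0 a c) + A.ncoef q (A.ncoef 0 a b) c := by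
  have h := A.commutator_formula 0 q a b c
  simp [zBinom_zero_right] at h
  rw [← h]
  abel

theorem ncoef_one_ncoef (q : ℤ) (a b c : V) :
    A.ncoef 1 a (A.ncoef q b c) = A.ncoef q b (A.ncoef 1 a c)
      + A.ncoef (q + 1) (A.ncoef 0 a b) c + A.ncoef q (A.ncoef 1 a b) c := by
  have h := A.commutator_formula 1 q a b c
  simp [Finset.sum_range_succ, zBinom, add_comm (1 : ℤ) q] at h
  rw [add_assoc, ← h]
  abel

theorem ncoef_two_ncoef [CharZero K] (q : ℤ) (a b c : V) :
    A.ncoef 2 a (A.ncoef q b c) = A.ncoef q b (A.ncoef 2 a c)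
      + (A.ncoef (q + 2) (A.ncoef 0 a b) c + (2 : K) • A.ncoef (q + 1) (A.ncoef 1 a b) c
        + A.ncoef q (A.ncoef 2 a b) c) := by
  have h := A.commutator_formula 2 q a b c
  have e1 : q + 2 - 1 = q + 1 := by ring
  have e3 : (2 : K) * (2 - 1) / 2 = 1 := by norm_num
  simp [Finset.sum_range_succ, Finset.prod_range_succ, zBinom, e3, add_comm (2 : ℤ) q] at h
  rw [e1] at h
  rw [← h]
  abel

theorem skew_symmetry [CharZero K] (p : ℤ) (a b : V) :
    A.ncoef p b a = -(((p.negOnePow : ℤ) : K) •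
      ∑ᶠ i : ℕ, (-1 : K) ^ i • A.ncoef (-1 - i) (A.ncoef (p + i) a b) A.vac) := by
  have h := A.borcherds a b A.vac p 0 (-1)
  rw [finsum_eq_single (fun i : ℕ => ((-1 : K) ^ i * zBinom K p i) • _) 0] at h
  · have e : A.ncoef 0 b A.vac = 0 := A.ncoef_vac_zero 0 le_rfl b
    have hs : ((p.negOnePow : ℤ) : K) * ((p.negOnePow : ℤ) : K) = 1 := by
      rw [← Int.cast_mul, ← Units.val_mul, ← Int.negOnePow_add, ← two_mul, Int.negOnePow_two_mul]
      simp
    simp only [zBinom_neg_one, zBinom_zero_right, add_zero, Nat.cast_zero, sub_zero, pow_zero,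
      one_mul, one_smul, e, map_zero, A.ncoef_vac, zero_sub] at h
    rw [h, smul_neg, neg_neg, smul_smul, hs, one_smul]
  · intro i hi
    have e1 : A.ncoef i b A.vac = 0 := A.ncoef_vac_zero _ (by omega) b
    have e2 : A.ncoef (-1 + (i : ℤ)) a A.vac = 0 := A.ncoef_vac_zero _ (by omega) a
    simp [e1, e2]

theorem T_ncoef [CharZero K] (n : ℤ) (b c : V) :
    A.ncoef n (A.T b) c = -((n : K) • A.ncoef (n - 1) b c) := by
  have h := A.borcherds b A.vac c (-2) n 0
  rw [finsum_eq_single (fun i : ℕ => zBinom K 0 i • _) 0] at h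
  · have hT : A.ncoef (-2) b A.vac = A.T b := rfl
    simp only [zBinom_zero_right, Nat.cast_zero, add_zero, sub_zero, zero_add, one_smul, hT,
      zBinom_neg_two, A.vac_ncoef, ← mul_assoc, neg_one_pow_mul_self_eq_one, one_mul] at h
    rw [h]
    have hs : (((-2 : ℤ).negOnePow : ℤ) : K) = 1 := by
      rw [show (-2 : ℤ) = 2 * (-1) by norm_num, Int.negOnePow_two_mul]
      simp
    rw [hs]
    rcases lt_trichotomy n 0 with hn | hn | hn
    · obtain ⟨k, rfl⟩ : ∃ k : ℕ, n = -1 - k := ⟨(-1 - n).toNat, by omega⟩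
      rw [finsum_eq_single _ k]
      · have e : ¬ (-2 + (-1 - (k : ℤ)) - k = -1) := by omega
        have e' : (-1 - (k : ℤ) - 1) = -2 - k := by ring
        simp only [sub_add_cancel, if_true, e, if_false, smul_zero, sub_zero, e', ← neg_smul]
        congr 1
        push_cast
        ring
      · intro i hi
        have e : ¬ (-2 + (-1 - (k : ℤ)) - i = -1) := by omega
        have e' : ¬ (-1 - (k : ℤ) + i = -1) := by omega
        simp [e, e']
    · subst hn
      rw [finsum_eq_zero_of_forall_eq_zero]
      · simp
      · intro i
        have e : ¬ (-2 + (0 : ℤ) - i = -1) := by omega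
        have e' : ¬ ((0 : ℤ) + i = -1) := by omega
        simp only [e, e', if_false]
        simp
    · obtain ⟨k, rfl⟩ : ∃ k : ℕ, n = 1 + k := ⟨(n - 1).toNat, by omega⟩
      rw [finsum_eq_single _ k]
      · have e : (-2 + (1 + (k : ℤ)) - k = -1) := by ring
        have e' : ¬ (1 + (k : ℤ) + k = -1) := by omega
        simp only [e, e', if_true, if_false, map_zero, one_smul, zero_sub, add_sub_cancel_left]
        rw [smul_neg]
        congr 2
        push_cast
        ring
      · intro i hi
        have e : ¬ (-2 + (1 + (k : ℤ)) - i = -1) := by omega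
        have e' : ¬ (1 + (k : ℤ) + i = -1) := by omega
        simp [e, e']
  · intro i hi
    have h0 : zBinom K ((0 : ℕ) : ℤ) i = 0 :=
      zBinom_natCast_eq_zero_of_lt (Nat.pos_of_ne_zero hi)
    rw [Nat.cast_zero] at h0
    rw [h0, zero_smul]

theorem T_ncoef_zero [CharZero K] (b : V) : A.ncoef 0 (A.T b) = 0 := by
  ext c
  simp [T_ncoef]

theorem ncoef_mem_span_ncoef (a b c : V) (n q : ℤ) :
    A.ncoef n a (A.ncoef q b c) ∈
      Submodule.span K (Set.range fun x : ℤ × V => A.ncoef x.1 x.2 c) := by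
  obtain ⟨N, hN⟩ := A.trunc b c
  obtain ⟨M, hM⟩ := A.trunc a c
  set J := Submodule.span K (Set.range fun x : ℤ × V => A.ncoef x.1 x.2 c) with hJ
  have key : ∀ t : ℕ, ∀ q n : ℤ, N - q ≤ t → A.ncoef n a (A.ncoef q b c) ∈ J := by
    intro t
    induction t with
    | zero =>
      intro q n hq
      rw [hN q (by simpa using hq), map_zero]
      exact J.zero_mem
    | succ t ih =>
      intro q n hq
      have h := A.borcherds a b c (n - M) q M
      have hl : (∑ᶠ i : ℕ, zBinom K M i •
          A.ncoef (M + q - (i : ℤ)) (A.ncoef (n - M + (i : ℤ)) a b) c) ∈ J :=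
        finsum_induction (· ∈ J) J.zero_mem (fun _ _ hx hy => J.add_mem hx hy)
          fun i => J.smul_mem _ (Submodule.subset_span ⟨(_, _), rfl⟩)
      rw [h, finsum_eq_sum_of_support_subset (s := Finset.range ((N - q).toNat + 1)),
        Finset.sum_range_succ'] at hl
      · have h2 := (J.add_mem_iff_right (J.sum_mem fun i _ => ?_)).mp hl
        · simpa [zBinom_zero_right, hM M le_rfl] using h2
        · refine J.smul_mem _ ?_
          rw [hM _ (by omega), map_zero, smul_zero, sub_zero]
          exact ih _ _ (by push_cast at *; omega)
      · intro i hi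
        by_contra hmem
        refine hi ?_
        have hlt : (N - q).toNat < i := by simpa using hmem
        simp [hN (q + i) (by omega), hM (M + i) (by omega)]
  exact key (N - q).toNat q n (Int.self_le_toNat _)

end Identities

end VA

namespace GradedVA

section Projections

variable {K V : Type*} [Field K] [AddCommGroup V] [Module K V] {A : VA K V} (G : GradedVA A)

/-- The canonical projection onto `V_n` as a linear endomorphism of `V`. -/
def proj (n : ℤ) : V →ₗ[K] V :=
  letI := G.decomp
  (G.gr n).subtype ∘ₗ DirectSum.component K ℤ (fun i => G.gr i) n ∘ₗ
    (DirectSum.decomposeLinearEquiv G.gr).toLinearMap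

theorem proj_apply (n : ℤ) (x : V) :
    G.proj n x = (let _ := G.decomp; (DirectSum.decompose G.gr x n : V)) := rfl

theorem proj_mem (n : ℤ) (x : V) : G.proj n x ∈ G.gr n := by
  rw [proj_apply]
  exact Subtype.prop _

theorem proj_of_mem {n : ℤ} {x : V} (hx : x ∈ G.gr n) : G.proj n x = x :=
  let _ := G.decomp
  DirectSum.decompose_of_mem_same G.gr hx

theorem proj_of_mem_ne {n i : ℤ} {x : V} (hx : x ∈ G.gr i) (h : i ≠ n) : G.proj n x = 0 :=
  let _ := G.decomp
  DirectSum.decompose_of_mem_ne G.gr hx h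

theorem exists_eq_sum_proj (x : V) : ∃ s : Finset ℤ, x = ∑ i ∈ s, G.proj i x := by
  classical
  let _ := G.decomp
  exact ⟨_, (DirectSum.sum_support_decompose G.gr x).symm⟩

theorem eq_zero_of_proj {x : V} (h : ∀ n, G.proj n x = 0) : x = 0 := by
  obtain ⟨s, hs⟩ := G.exists_eq_sum_proj x
  rw [hs]
  exact Finset.sum_eq_zero fun i _ => h i

theorem proj_map_of_homogeneous {d : ℤ} (f : V →ₗ[K] V) (hf : ∀ i, ∀ x ∈ G.gr i, f x ∈ G.gr (i + d))
    (i : ℤ) (x : V) : G.proj (i + d) (f x) = f (G.proj i x) := by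
  obtain ⟨s, hs⟩ := G.exists_eq_sum_proj x
  have key : ∀ j, G.proj (i + d) (f (G.proj j x)) = f (G.proj i (G.proj j x)) := by
    intro j
    rcases eq_or_ne j i with rfl | hj
    · rw [G.proj_of_mem (hf _ _ (G.proj_mem _ x)), G.proj_of_mem (G.proj_mem _ x)]
    · rw [G.proj_of_mem_ne (hf _ _ (G.proj_mem _ x)) (by omega),
        G.proj_of_mem_ne (G.proj_mem _ x) hj, map_zero]
  rw [hs]
  simp only [map_sum, key]

/-- The vectors all of whose components of degree less than `n` vanish. -/
def filtration (n : ℤ) : Submodule K V := ⨅ i : Set.Iio n, LinearMap.ker (G.proj i)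

theorem mem_filtration {n : ℤ} {x : V} : x ∈ G.filtration n ↔ ∀ i < n, G.proj i x = 0 := by
  simp [filtration, Submodule.mem_iInf]

theorem filtration_anti {n m : ℤ} (h : n ≤ m) : G.filtration m ≤ G.filtration n := by
  intro x hx
  rw [mem_filtration] at *
  exact fun i hi => hx i (by omega)

theorem gr_le_filtration {n i : ℤ} (h : n ≤ i) : G.gr i ≤ G.filtration n := by
  intro x hx
  rw [mem_filtration]
  exact fun j hj => G.proj_of_mem_ne hx (by omega)

theorem mem_filtration_succ {n : ℤ} {x : V} :
    x ∈ G.filtration (n + 1) ↔ x ∈ G.filtration n ∧ G.proj n x = 0 := by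
  simp only [mem_filtration]
  refine ⟨fun h => ⟨fun i hi => h i (by omega), h n (by omega)⟩, fun h i hi => ?_⟩
  rcases eq_or_ne i n with rfl | hne
  · exact h.2
  · exact h.1 i (by omega)

theorem sub_proj_mem_filtration {n : ℤ} {x : V} (hx : x ∈ G.filtration n) :
    x - G.proj n x ∈ G.filtration (n + 1) := by
  rw [mem_filtration_succ]
  refine ⟨sub_mem hx (G.gr_le_filtration le_rfl (G.proj_mem n x)), ?_⟩
  rw [map_sub, G.proj_of_mem (G.proj_mem n x), sub_self]

theorem ncoef_mem_filtration {n m : ℤ} (k : ℤ) {x y : V} (hx : x ∈ G.filtration n)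
    (hy : y ∈ G.filtration m) : A.ncoef k x y ∈ G.filtration (n + m - k - 1) := by
  obtain ⟨s, hs⟩ := G.exists_eq_sum_proj x
  obtain ⟨t, ht⟩ := G.exists_eq_sum_proj y
  rw [hs, ht]
  simp only [map_sum, LinearMap.sum_apply]
  refine Submodule.sum_mem _ fun i _ => Submodule.sum_mem _ fun j _ => ?_
  rcases lt_or_ge i m with hi | hi
  · rw [G.mem_filtration.mp hy i hi, map_zero]
    exact zero_mem _
  rcases lt_or_ge j n with hj | hj
  · rw [G.mem_filtration.mp hx j hj, map_zero, LinearMap.zero_apply]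
    exact zero_mem _
  exact G.gr_le_filtration (by omega)
    (G.ncoef_mem j i k _ (G.proj_mem j x) _ (G.proj_mem i y))

theorem proj_ncoef_of_mem_filtration {n m : ℤ} (k : ℤ) {x y : V} (hx : x ∈ G.filtration n)
    (hy : y ∈ G.filtration m) :
    G.proj (n + m - k - 1) (A.ncoef k x y) = A.ncoef k (G.proj n x) (G.proj m y) := by
  have e : A.ncoef k x y = A.ncoef k (x - G.proj n x) y
      + (A.ncoef k (G.proj n x) (y - G.proj m y) + A.ncoef k (G.proj n x) (G.proj m y)) := by
    simp only [map_sub, LinearMap.sub_apply]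
    abel
  have h1 := G.ncoef_mem_filtration k (G.sub_proj_mem_filtration hx) hy
  have h2 := G.ncoef_mem_filtration k (G.gr_le_filtration le_rfl (G.proj_mem n x))
    (G.sub_proj_mem_filtration hy)
  rw [e, map_add, map_add, G.mem_filtration.mp h1 _ (by omega),
    G.mem_filtration.mp h2 _ (by omega), zero_add, zero_add,
    G.proj_of_mem (G.ncoef_mem n m k _ (G.proj_mem n x) _ (G.proj_mem m y))]

theorem T_mem {n : ℤ} {x : V} (hx : x ∈ G.gr n) : A.T x ∈ G.gr (n + 1) := by
  have h := G.ncoef_mem n 0 (-2) x hx _ G.vac_mem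
  rwa [show n + 0 - (-2) - 1 = n + 1 by ring] at h

end Projections

end GradedVA

namespace ConfGVA

section Conformal

variable {K V : Type*} [Field K] [AddCommGroup V] [Module K V] {A : VA K V}

theorem proj_L0 (C : ConfGVA A) (n : ℤ) (x : V) :
    C.proj n (A.ncoef 1 C.ω x) = (n : K) • C.proj n x := by
  have h := C.proj_map_of_homogeneous (d := 0) (A.ncoef 1 C.ω)
    (fun i y hy => by simpa [C.L0_grading i y hy] using (C.gr i).smul_mem _ hy) n x
  rwa [add_zero, C.L0_grading n _ (C.proj_mem n x)] at h

variable [CharZero K]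

theorem T_ncoef_vac (C : ConfGVA A) (n : ℕ) (x : V) :
    A.T (A.ncoef (-1 - n) x A.vac)
      = ((n : K) + 1) • A.ncoef (-1 - (n + 1 : ℕ)) x A.vac := by
  rw [← C.Lneg1_eq_T, A.ncoef_zero_ncoef, A.ncoef_vac_zero 0 le_rfl, map_zero, zero_add,
    C.Lneg1_eq_T, A.T_ncoef, ← neg_smul]
  congr 1
  · push_cast
    ring
  · congr 3
    push_cast
    ring

theorem ncoef_vac_mem_range_T (C : ConfGVA A) (n : ℕ) (x : V) :
    ∃ y, A.ncoef (-1 - (n + 1 : ℕ)) x A.vac = A.T y := by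
  have hn : (n : K) + 1 ≠ 0 := by exact_mod_cast n.succ_ne_zero
  refine ⟨((n : K) + 1)⁻¹ • A.ncoef (-1 - n) x A.vac, ?_⟩
  rw [map_smul, C.T_ncoef_vac, smul_smul, inv_mul_cancel₀ hn, one_smul]

theorem ncoef_vac_mem_range_T_T (C : ConfGVA A) (n : ℕ) (x : V) :
    ∃ y, A.ncoef (-1 - (n + 2 : ℕ)) x A.vac = A.T (A.T y) := by
  have hn : ((n + 1 : ℕ) : K) + 1 ≠ 0 := by exact_mod_cast (n + 1).succ_ne_zero
  obtain ⟨y, hy⟩ := C.ncoef_vac_mem_range_T n x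
  refine ⟨(((n + 1 : ℕ) : K) + 1)⁻¹ • y, ?_⟩
  rw [map_smul, ← hy, map_smul, C.T_ncoef_vac, smul_smul, inv_mul_cancel₀ hn, one_smul]

theorem mem_gr_zero_of_T_eq_zero (C : ConfGVA A) {x : V} (hx : A.T x = 0) : x ∈ C.gr 0 := by
  have h0 : ∀ n : ℕ, ∀ y, A.ncoef n x y = 0 := by
    intro n y
    have h := A.T_ncoef (n + 1 : ℕ) x y
    have hn : ((n : K) + 1) ≠ 0 := by exact_mod_cast n.succ_ne_zero
    rw [hx, map_zero, LinearMap.zero_apply, eq_comm, neg_eq_zero] at h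
    push_cast at h
    simpa [hn] using h
  have hL : A.ncoef 1 C.ω x = 0 := by
    rw [A.skew_symmetry, finsum_eq_zero_of_forall_eq_zero, smul_zero, neg_zero]
    intro i
    have h := h0 (1 + i) C.ω
    push_cast at h
    rw [h, map_zero, LinearMap.zero_apply, smul_zero]
  have hp : ∀ n, n ≠ 0 → C.proj n x = 0 := by
    intro n hn
    have h := C.proj_L0 n x
    rw [hL, map_zero, eq_comm] at h
    simpa [hn] using h
  obtain ⟨s, hs⟩ := C.exists_eq_sum_proj x
  rw [hs]
  refine Submodule.sum_mem _ fun i _ => ?_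
  rcases eq_or_ne i 0 with rfl | hi
  · exact C.proj_mem 0 x
  · rw [hp i hi]
    exact zero_mem _

theorem exists_T_sub_L0_add_T_eq_zero (C : ConfGVA A) {b : V} (hb : A.ncoef 0 b = 0) :
    ∃ y, A.T (b - A.ncoef 1 C.ω b + A.T y) = 0 := by
  obtain ⟨N, hN⟩ := A.trunc C.ω b
  have h := A.skew_symmetry 0 C.ω b
  rw [hb, LinearMap.zero_apply, finsum_eq_sum_of_support_subset (s := Finset.range (N.toNat + 2)),
    Finset.sum_range_succ', Finset.sum_range_succ'] at h
  · have hR : ∑ i ∈ Finset.range N.toNat, (-1 : K) ^ (i + 1 + 1) •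
        A.ncoef (-1 - ((i + 1 + 1 : ℕ) : ℤ)) (A.ncoef (0 + ((i + 1 + 1 : ℕ) : ℤ)) C.ω b) A.vac
          ∈ LinearMap.range (A.T ∘ₗ A.T) := by
      refine Submodule.sum_mem _ fun i _ => Submodule.smul_mem _ _ ?_
      obtain ⟨y, hy⟩ := C.ncoef_vac_mem_range_T_T i (A.ncoef (0 + ((i + 1 + 1 : ℕ) : ℤ)) C.ω b)
      exact ⟨y, hy.symm⟩
    obtain ⟨y, hy⟩ := hR
    have hT : ∀ x, A.ncoef (-2) x A.vac = A.T x := fun x => rfl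
    refine ⟨y, ?_⟩
    rw [← hy] at h
    simp [hT, C.Lneg1_eq_T, A.ncoef_vac] at h
    rw [map_add, map_sub, ← neg_eq_zero, h]
    abel
  · intro i hi
    by_contra hmem
    refine hi ?_
    have hlt : N.toNat + 2 ≤ i := by simpa using hmem
    simp [hN (i : ℤ) (by omega)]

end Conformal

end ConfGVA

namespace VOACFT

section CFT

variable {K V : Type*} [Field K] [AddCommGroup V] [Module K V] {A : VA K V}
  (W : VOACFT A)

theorem gr_le_span_vac {n : ℤ} (hn : n ≤ 0) {x : V} (hx : x ∈ W.gr n) : ∃ c : K, c • A.vac = x := by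
  rcases hn.lt_or_eq with hn | rfl
  · rw [W.gr_neg n hn, Submodule.mem_bot] at hx
    exact ⟨0, by rw [hx, zero_smul]⟩
  · rw [W.gr_zero] at hx
    exact Submodule.mem_span_singleton.mp hx

theorem eq_zero_of_mem_gr_neg {n : ℤ} (hn : n < 0) {x : V} (hx : x ∈ W.gr n) : x = 0 := by
  rwa [W.gr_neg n hn, Submodule.mem_bot] at hx

theorem mem_filtration_zero (x : V) : x ∈ W.filtration 0 := by
  rw [GradedVA.mem_filtration]
  exact fun i hi => W.eq_zero_of_mem_gr_neg hi (W.proj_mem i x)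

variable [CharZero K]

/-- Skew-symmetry for products in degree at most zero, where only the leading term survives. -/
theorem ncoef_comm_of_degree_nonpos {d e p : ℤ} (h : d + e - p - 1 ≤ 0) {x y : V}
    (hx : x ∈ W.gr d) (hy : y ∈ W.gr e) :
    A.ncoef p y x = -(((p.negOnePow : ℤ) : K) • A.ncoef p x y) := by
  rw [A.skew_symmetry, finsum_eq_single _ 0]
  · simp [A.ncoef_vac]
  · intro i hi
    rw [W.eq_zero_of_mem_gr_neg _ (W.ncoef_mem d e (p + i) x hx y hy), map_zero,
      LinearMap.zero_apply, smul_zero]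
    omega

/-- A vector with vanishing zeroth mode is, modulo constants and total derivatives, its
component of degree one. -/
theorem exists_eq_add_T_of_ncoef_zero_eq_zero {b : V} (hb : A.ncoef 0 b = 0) :
    ∃ v ∈ W.gr 1, A.ncoef 0 v = 0 ∧ ∃ (c : K) (u : V), b = v + c • A.vac + A.T u := by
  set R : Submodule K V := Submodule.span K {A.vac} ⊔ LinearMap.range A.T with hR
  have hvac : ∀ c : K, c • A.vac ∈ R := fun c =>
    Submodule.mem_sup_left (Submodule.smul_mem _ _ (Submodule.mem_span_singleton_self _))
  have hT : ∀ u, A.T u ∈ R := fun u => Submodule.mem_sup_right ⟨u, rfl⟩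
  obtain ⟨y, hy⟩ := W.exists_T_sub_L0_add_T_eq_zero hb
  have hz := W.mem_gr_zero_of_T_eq_zero hy
  have hp : ∀ d, d ≠ 1 → W.proj d b ∈ R := by
    intro d hd
    rcases eq_or_ne d 0 with rfl | hd0
    · obtain ⟨c, hc⟩ := W.gr_le_span_vac le_rfl (W.proj_mem 0 b)
      rw [← hc]
      exact hvac c
    · have h1 := W.proj_of_mem_ne hz hd0.symm
      have h2 := W.proj_map_of_homogeneous A.T (fun i x hx => W.T_mem hx) (d - 1) y
      rw [sub_add_cancel] at h2
      rw [map_add, map_sub, W.proj_L0, h2] at h1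
      have hne : (1 : K) - d ≠ 0 := by
        rw [sub_ne_zero]
        exact_mod_cast hd.symm
      have h3 : ((1 : K) - d) • W.proj d b = A.T (-W.proj (d - 1) y) := by
        rw [sub_smul, one_smul, map_neg]
        exact eq_neg_of_add_eq_zero_left h1
      have h4 := R.smul_mem ((1 : K) - d)⁻¹ (h3 ▸ hT (-W.proj (d - 1) y))
      rwa [smul_smul, inv_mul_cancel₀ hne, one_smul] at h4
  have hmem : b - W.proj 1 b ∈ R := by
    obtain ⟨s, hs⟩ := W.exists_eq_sum_proj (b - W.proj 1 b)
    rw [hs]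
    refine Submodule.sum_mem _ fun i _ => ?_
    rw [map_sub]
    rcases eq_or_ne i 1 with rfl | hi
    · rw [W.proj_of_mem (W.proj_mem 1 b), sub_self]
      exact zero_mem _
    · rw [W.proj_of_mem_ne (W.proj_mem 1 b) hi.symm, sub_zero]
      exact hp i hi
  obtain ⟨z, hz1, t, ⟨u, rfl⟩, hzt⟩ := Submodule.mem_sup.mp hmem
  obtain ⟨c, rfl⟩ := Submodule.mem_span_singleton.mp hz1
  have hbeq : b = W.proj 1 b + c • A.vac + A.T u := by
    rw [add_assoc, hzt]
    abel
  refine ⟨_, W.proj_mem 1 b, ?_, c, u, hbeq⟩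
  have h0 : A.ncoef 0 A.vac = 0 := by
    ext x
    rw [A.vac_ncoef]
    simp
  rw [hbeq, map_add, map_add, map_smul, A.T_ncoef_zero, h0, smul_zero, add_zero, add_zero] at hb
  exact hb

end CFT

end VOACFT

namespace VOAsCFT

section StrongCFT

variable {K V : Type*} [Field K] [CharZero K] [AddCommGroup V] [Module K V] {A : VA K V}
  (W : VOAsCFT A)

/-- A degree one vector orthogonal to `V_1` pairs trivially with every homogeneous vector. -/
theorem ncoef_eq_zero_of_orthogonal {u : V} (hu : u ∈ W.gr 1)
    (h1 : ∀ w ∈ W.gr 1, A.ncoef 1 u w = 0) :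
    ∀ (d : ℕ), ∀ x ∈ W.gr d, A.ncoef d u x = 0 := by
  intro d
  induction d with
  | zero =>
    intro x hx
    obtain ⟨c, rfl⟩ := W.gr_le_span_vac le_rfl hx
    rw [map_smul, Nat.cast_zero, A.ncoef_vac_zero 0 le_rfl, smul_zero]
  | succ d ih =>
    rcases Nat.eq_zero_or_pos d with rfl | hd
    · simpa using h1
    intro x hx
    have h := A.ncoef_two_ncoef d W.ω u x
    have hL1x : A.ncoef 2 W.ω x ∈ W.gr d := by
      have := W.ncoef_mem 2 _ 2 _ W.ω_mem _ hx
      push_cast at this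
      rwa [show (2 : ℤ) + (d + 1) - 2 - 1 = d by ring] at this
    have hux : A.ncoef d u x ∈ W.gr 1 := by
      have := W.ncoef_mem 1 _ d _ hu _ hx
      push_cast at this
      rwa [show (1 : ℤ) + (d + 1) - d - 1 = 1 by ring] at this
    rw [W.L1_V1 _ hux, ih _ hL1x, W.L1_V1 u hu, W.L0_grading 1 u hu, W.Lneg1_eq_T, A.T_ncoef,
      map_zero, LinearMap.zero_apply, show (d : ℤ) + 2 - 1 = d + 1 by ring] at h
    have hd0 : (d : K) ≠ 0 := by exact_mod_cast hd.ne'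
    have h2 : (d : K) • A.ncoef (d + 1) u x = 0 := by
      rw [← neg_eq_zero, h]
      simp
      module
    push_cast
    simpa [hd0] using h2

/-- In a simple vertex operator algebra of strong CFT type the pairing `(u, w) ↦ u(1)w` on
`V_1` is nondegenerate. -/
theorem eq_zero_of_orthogonal (hs : A.IsSimple) {u : V} (hu : u ∈ W.gr 1)
    (h1 : ∀ w ∈ W.gr 1, A.ncoef 1 u w = 0) : u = 0 := by
  let I : Submodule K V := ⨅ x : V, ⨅ n : ℤ, LinearMap.ker (W.proj 0 ∘ₗ A.ncoef n x)
  have hI : ∀ w, w ∈ I ↔ ∀ x n, W.proj 0 (A.ncoef n x w) = 0 := by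
    intro w
    simp [I, Submodule.mem_iInf]
  have hleft : ∀ n y, ∀ w ∈ I, A.ncoef n y w ∈ I := by
    intro n y w hw
    rw [hI] at *
    intro x k
    have hle : Submodule.span K (Set.range fun x : ℤ × V => A.ncoef x.1 x.2 w)
        ≤ LinearMap.ker (W.proj 0) := by
      rw [Submodule.span_le]
      rintro _ ⟨z, rfl⟩
      exact hw z.2 z.1
    exact hle (A.ncoef_mem_span_ncoef x y w k n)
  have hS : ∀ (i : ℕ), ∀ w ∈ I, A.ncoef (-1 - i) w A.vac ∈ I := by
    intro i w hw
    induction i with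
    | zero => simpa [A.ncoef_vac] using hw
    | succ i ih =>
      have hi : (i : K) + 1 ≠ 0 := by exact_mod_cast i.succ_ne_zero
      have h := hleft 0 W.ω _ ih
      rw [W.Lneg1_eq_T, W.T_ncoef_vac] at h
      have h' := I.smul_mem ((i : K) + 1)⁻¹ h
      rwa [smul_smul, inv_mul_cancel₀ hi, one_smul] at h'
  have hideal : A.IsIdeal I := by
    intro n y w hw
    refine ⟨hleft n y w hw, ?_⟩
    rw [A.skew_symmetry]
    exact I.neg_mem (I.smul_mem _ (finsum_induction (· ∈ I) I.zero_mem
      (fun _ _ hx hy => I.add_mem hx hy)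
      fun i => I.smul_mem _ (hS i _ (hleft _ _ _ hw))))
  have huI : u ∈ I := by
    rw [hI]
    intro x n
    obtain ⟨s, hx⟩ := W.exists_eq_sum_proj x
    rw [hx]
    simp only [map_sum, LinearMap.sum_apply]
    refine Finset.sum_eq_zero fun d _ => ?_
    have hxd := W.proj_mem d x
    have hmem := W.ncoef_mem d 1 n _ hxd u hu
    rcases eq_or_ne (d + 1 - n - 1) 0 with hd | hd
    · obtain rfl : n = d := by omega
      rcases lt_or_ge n 0 with hn | hn
      · rw [W.eq_zero_of_mem_gr_neg hn hxd]
        simp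
      · obtain ⟨k, rfl⟩ := Int.eq_ofNat_of_zero_le hn
        rw [W.ncoef_comm_of_degree_nonpos (by omega) hu hxd,
          W.ncoef_eq_zero_of_orthogonal hu h1 k _ hxd]
        simp
    · exact W.proj_of_mem_ne hmem hd
  rcases hs I hideal with hbot | htop
  · rwa [hbot, Submodule.mem_bot] at huI
  · have hv : A.vac ∈ I := htop ▸ Submodule.mem_top
    have hv0 := (hI _).mp hv A.vac (-1)
    rw [A.ncoef_vac, W.proj_of_mem W.vac_mem] at hv0
    rw [← A.ncoef_vac u, hv0, map_zero]

end StrongCFT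

end VOAsCFT

theorem LinearMap.mem_of_sum_eigenvectors_mem {K V : Type*} [Field K] [CharZero K]
    [AddCommGroup V] [Module K V] (E : V →ₗ[K] V) {p : Submodule K V} (hE : ∀ x ∈ p, E x ∈ p)
    (s : Finset ℤ) :
    ∀ z : ℤ → V, (∀ k, E (z k) = (k : K) • z k) → ∑ k ∈ s, z k ∈ p → ∀ k ∈ s, z k ∈ p := by
  classical
  induction s using Finset.induction_on with
  | empty => simp
  | insert j s hj ih =>
    intro z hz hsum
    have h1 : ∑ k ∈ s, ((k : K) - j) • z k ∈ p := by
      have h2 := p.sub_mem (hE _ hsum) (p.smul_mem (j : K) hsum)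
      rw [map_sum, Finset.smul_sum, ← Finset.sum_sub_distrib, Finset.sum_insert hj, hz, sub_self,
        zero_add] at h2
      simpa only [hz, sub_smul] using h2
    have h3 : ∀ k ∈ s, z k ∈ p := by
      intro k hk
      have h4 := ih (fun k => ((k : K) - j) • z k)
        (fun k => by rw [map_smul, hz, smul_comm]) h1 k hk
      have hne : (k : K) - j ≠ 0 := by
        rw [sub_ne_zero]
        exact_mod_cast fun h : k = j => hj (h ▸ hk)
      have h5 := p.smul_mem ((k : K) - j)⁻¹ h4
      rwa [smul_smul, inv_mul_cancel₀ hne, one_smul] at h5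
    intro k hk
    rcases Finset.mem_insert.mp hk with rfl | hk
    · rw [Finset.sum_insert hj] at hsum
      exact (p.add_mem_iff_left (p.sum_mem h3)).mp hsum
    · exact h3 k hk

namespace VA

section Automorphisms

variable {K V : Type*} [Field K] [AddCommGroup V] [Module K V] (A : VA K V)

theorem mem_eig {a x : V} {n : ℤ} : x ∈ A.eig a n ↔ A.ncoef 1 a x = (n : K) • x := by
  simp [eig, sub_eq_zero]

theorem ncoef_mem_eig [CharZero K] {a : V} (h0 : A.ncoef 0 a = A.T) {n m k : ℤ} {x y : V}
    (hx : x ∈ A.eig a n) (hy : y ∈ A.eig a m) : A.ncoef k x y ∈ A.eig a (n + m - k - 1) := by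
  rw [mem_eig] at *
  rw [A.ncoef_one_ncoef, hx, hy, h0, A.T_ncoef, add_sub_cancel_right]
  simp only [map_smul, LinearMap.smul_apply]
  push_cast
  module

theorem exists_finset_sum_eig {a : V} (hspan : ⨆ n, A.eig a n = ⊤) (x : V) :
    ∃ (s : Finset ℤ) (z : ℤ → V), (∀ k, z k ∈ A.eig a k) ∧ x = ∑ k ∈ s, z k := by
  have hx : x ∈ ⨆ n, A.eig a n := hspan ▸ Submodule.mem_top
  obtain ⟨f, hf, rfl⟩ := (Submodule.mem_iSup_iff_exists_finsupp _ _).mp hx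
  exact ⟨f.support, f, hf, rfl⟩

theorem isInternal_eig [CharZero K] {a : V} (hspan : ⨆ n, A.eig a n = ⊤) :
    DirectSum.IsInternal (A.eig a) := by
  rw [DirectSum.isInternal_submodule_iff_iSupIndep_and_iSup_eq_top]
  refine ⟨?_, hspan⟩
  have h := (Module.End.eigenspaces_iSupIndep (A.ncoef 1 a)).comp (Int.cast_injective (α := K))
  have e : A.eig a = Module.End.eigenspace (A.ncoef 1 a) ∘ fun n : ℤ => (n : K) := by
    ext n x
    rw [mem_eig, Function.comp_apply, Module.End.mem_eigenspace_iff]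
  rwa [e]

variable {A}

theorem IsVAAut.exists_inverse {f : V → V} (hf : A.IsVAAut f) :
    ∃ g : V → V, A.IsVAAut g ∧ ∀ x, g (f x) = x := by
  obtain ⟨g, hgf, hfg⟩ := Function.bijective_iff_has_inverse.mp hf.2
  refine ⟨g, ⟨⟨fun x y => ?_, fun c x => ?_, fun n x y => ?_, ?_⟩, hfg.injective, hgf.surjective⟩,
    hgf⟩ <;> apply hf.2.injective
  · simp only [hf.1.map_add, hfg _]
  · simp only [hf.1.map_smul, hfg _]
  · simp only [hf.1.map_ncoef, hfg _]
  · rw [hfg, hf.1.map_vac]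

theorem IsVAAut.comp {f g : V → V} (hf : A.IsVAAut f) (hg : A.IsVAAut g) :
    A.IsVAAut (f ∘ g) := by
  refine ⟨⟨fun x y => ?_, fun c x => ?_, fun n x y => ?_, ?_⟩, hf.2.comp hg.2⟩
  · simp only [Function.comp_apply, hf.1.map_add, hg.1.map_add]
  · simp only [Function.comp_apply, hf.1.map_smul, hg.1.map_smul]
  · simp only [Function.comp_apply, hf.1.map_ncoef, hg.1.map_ncoef]
  · simp only [Function.comp_apply, hf.1.map_vac, hg.1.map_vac]

theorem IsVAHom.map_T {f : V → V} (hf : A.IsVAHom f) (x : V) : f (A.T x) = A.T (f x) := by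
  change f (A.ncoef (-2) x A.vac) = A.ncoef (-2) (f x) A.vac
  rw [hf.map_ncoef, hf.map_vac]

end Automorphisms

end VA

namespace VOACFT

section LeadingTerms

variable {K V : Type*} [Field K] [CharZero K] [AddCommGroup V] [Module K V] {A : VA K V}
  (W : VOACFT A) {a : V}

theorem mem_filtration_of_eigenvector
    (hE : ∀ (m : ℤ), ∀ x ∈ W.filtration m, A.ncoef 1 a x - (m : K) • x ∈ W.filtration (m + 1))
    {n m : ℤ} (hne : n ≠ m) {x : V} (hx : x ∈ A.eig a n) (hm : x ∈ W.filtration m) :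
    x ∈ W.filtration (m + 1) := by
  have h := hE m x hm
  rw [A.mem_eig.mp hx, ← sub_smul] at h
  have hc : (n : K) - m ≠ 0 := by
    rw [sub_ne_zero]
    exact_mod_cast hne
  exact (Submodule.smul_mem_iff _ hc).mp h

theorem eig_le_filtration
    (hE : ∀ (m : ℤ), ∀ x ∈ W.filtration m, A.ncoef 1 a x - (m : K) • x ∈ W.filtration (m + 1))
    (n : ℤ) {x : V} (hx : x ∈ A.eig a n) : x ∈ W.filtration n := by
  have key : ∀ t : ℕ, (t : ℤ) ≤ n → x ∈ W.filtration t := by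
    intro t
    induction t with
    | zero => exact fun _ => W.mem_filtration_zero x
    | succ t ih =>
      intro ht
      push_cast at ht ⊢
      exact W.mem_filtration_of_eigenvector hE (by omega) hx (ih (by omega))
  rcases le_or_gt 0 n with hn | hn
  · obtain ⟨k, rfl⟩ := Int.eq_ofNat_of_zero_le hn
    exact key k le_rfl
  · exact W.filtration_anti hn.le (W.mem_filtration_zero x)

theorem eq_zero_of_eigenvector
    (hE : ∀ (m : ℤ), ∀ x ∈ W.filtration m, A.ncoef 1 a x - (m : K) • x ∈ W.filtration (m + 1))
    {n m : ℤ} (hnm : n < m) {x : V} (hx : x ∈ A.eig a n) (hm : x ∈ W.filtration m) : x = 0 := by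
  have key : ∀ t : ℕ, x ∈ W.filtration (m + t) := by
    intro t
    induction t with
    | zero => simpa using hm
    | succ t ih =>
      have h := W.mem_filtration_of_eigenvector hE (by omega) hx ih
      push_cast
      rwa [← add_assoc]
  refine W.eq_zero_of_proj fun i => ?_
  exact W.mem_filtration.mp (key (i + 1 - m).toNat) i (by omega)

/-- If `a(1)` acts on the graded quotients of the degree filtration as the degree does, then
taking leading terms of eigenvectors of `a(1)` is an automorphism. -/
theorem exists_aut_leading_term (h0 : A.ncoef 0 a = A.T) (hspan : ⨆ n, A.eig a n = ⊤)
    (hE : ∀ (m : ℤ), ∀ x ∈ W.filtration m,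
      A.ncoef 1 a x - (m : K) • x ∈ W.filtration (m + 1)) :
    ∃ g : V → V, A.IsVAAut g ∧ ∀ k, ∀ x ∈ A.eig a k, g x = W.proj k x := by
  classical
  let e := LinearEquiv.ofBijective (DirectSum.coeLinearMap (A.eig a)) (A.isInternal_eig hspan)
  let g : V →ₗ[K] V := DirectSum.toModule K ℤ V (fun k => W.proj k ∘ₗ (A.eig a k).subtype) ∘ₗ
    e.symm.toLinearMap
  have hg : ∀ k, ∀ x ∈ A.eig a k, g x = W.proj k x := by
    intro k x hx
    have hex : e.symm x = DirectSum.lof K ℤ (fun k => A.eig a k) k ⟨x, hx⟩ := by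
      rw [LinearEquiv.symm_apply_eq]
      exact (DirectSum.coeLinearMap_lof (A.eig a) k ⟨x, hx⟩).symm
    simp only [g, LinearMap.comp_apply, LinearEquiv.coe_coe, hex, DirectSum.toModule_lof,
      Submodule.subtype_apply]
  have hinv : ∀ n, ∀ x ∈ W.filtration n, A.ncoef 1 a x ∈ W.filtration n := by
    intro n x hx
    have h := W.filtration_anti (show n ≤ n + 1 by omega) (hE n x hx)
    exact (Submodule.sub_mem_iff_left _ (Submodule.smul_mem _ _ hx)).mp h
  refine ⟨g, ⟨⟨map_add g, map_smul g, fun n x y => ?_, ?_⟩, ?_, ?_⟩, hg⟩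
  · obtain ⟨s, z, hz, rfl⟩ := A.exists_finset_sum_eig hspan x
    obtain ⟨t, w, hw, rfl⟩ := A.exists_finset_sum_eig hspan y
    simp only [map_sum, LinearMap.sum_apply]
    refine Finset.sum_congr rfl fun i _ => Finset.sum_congr rfl fun j _ => ?_
    rw [hg _ _ (A.ncoef_mem_eig h0 (hz _) (hw _)), hg _ _ (hz _), hg _ _ (hw _),
      W.proj_ncoef_of_mem_filtration n (W.eig_le_filtration hE _ (hz _))
        (W.eig_le_filtration hE _ (hw _))]
  · rw [hg 0, W.proj_of_mem W.vac_mem]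
    rw [A.mem_eig, A.ncoef_vac_zero 1 zero_le_one]
    simp
  · rw [injective_iff_map_eq_zero]
    intro x hx
    obtain ⟨s, z, hz, rfl⟩ := A.exists_finset_sum_eig hspan x
    refine Finset.sum_eq_zero fun j hj => ?_
    have hp := congrArg (W.proj j) hx
    rw [map_zero, map_sum, map_sum, Finset.sum_eq_single j, hg _ _ (hz _),
      W.proj_of_mem (W.proj_mem _ _)] at hp
    · exact W.eq_zero_of_eigenvector hE (lt_add_one j) (hz j)
        (W.mem_filtration_succ.mpr ⟨W.eig_le_filtration hE _ (hz _), hp⟩)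
    · intro i _ hij
      rw [hg _ _ (hz _), W.proj_of_mem_ne (W.proj_mem _ _) hij]
    · exact fun h => absurd hj h
  · intro x
    have hrange : ∀ n, W.gr n ≤ LinearMap.range g := by
      intro n x hx
      obtain ⟨s, z, hz, hxs⟩ := A.exists_finset_sum_eig hspan x
      have hzF : ∀ k ∈ s, z k ∈ W.filtration n :=
        LinearMap.mem_of_sum_eigenvectors_mem (A.ncoef 1 a) (hinv n) s z
          (fun k => A.mem_eig.mp (hz k)) (hxs ▸ W.gr_le_filtration le_rfl hx)
      have hproj : ∀ k ∈ s, W.proj n (z k) = if k = n then g (z k) else 0 := by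
        intro k hk
        split_ifs with h
        · rw [h, hg _ _ (hz n)]
        · rcases lt_or_gt_of_ne h with h | h
          · rw [W.eq_zero_of_eigenvector hE h (hz k) (hzF k hk), map_zero]
          · exact W.mem_filtration.mp (W.eig_le_filtration hE _ (hz k)) n h
      rw [← W.proj_of_mem hx, hxs, map_sum]
      refine Submodule.sum_mem _ fun k hk => ?_
      rw [hproj k hk]
      split_ifs
      · exact ⟨_, rfl⟩
      · exact zero_mem _
    obtain ⟨s, hs⟩ := W.exists_eq_sum_proj x
    have hx : x ∈ LinearMap.range g := by
      rw [hs]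
      exact Submodule.sum_mem _ fun i _ => hrange i (W.proj_mem i x)
    exact hx

end LeadingTerms

end VOACFT

namespace VOAsCFT

section PositivePart

variable {K V : Type*} [Field K] [CharZero K] [AddCommGroup V] [Module K V] {A : VA K V}
  (W : VOAsCFT A)

theorem ncoef_zero_self {u : V} (hu : u ∈ W.gr 1) : A.ncoef 0 u u = 0 := by
  have h := A.skew_symmetry 0 u u
  rw [finsum_eq_sum_of_support_subset (s := Finset.range 2)] at h
  · obtain ⟨c, hc⟩ := W.gr_le_span_vac (n := 0) le_rfl (by simpa using W.ncoef_mem 1 1 1 u hu u hu)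
    have hT : A.ncoef (-2) A.vac A.vac = 0 := A.T_vac
    simp [Finset.sum_range_succ, A.ncoef_vac, ← hc, hT] at h
    have h2 : (2 : K) • A.ncoef 0 u u = 0 := by
      rw [two_smul]
      nth_rewrite 1 [h]
      exact neg_add_cancel _
    simpa using h2
  · intro i hi
    by_contra hmem
    have hlt : 1 < i := by simpa using hmem
    refine hi ?_
    have hz : A.ncoef (0 + i) u u = 0 :=
      W.eq_zero_of_mem_gr_neg (by omega) (W.ncoef_mem 1 1 (0 + i) u hu u hu)
    simp only [hz, map_zero, LinearMap.zero_apply, smul_zero]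

/-- A degree one vector `u` annihilates, under `w ↦ u(1)w`, every eigenvector of `u(0)` in `V_1`
with nonzero eigenvalue. -/
theorem ncoef_one_eq_zero_of_eigenvector {u w : V} (hu : u ∈ W.gr 1) (hw : w ∈ W.gr 1) {l : K}
    (hl : l ≠ 0) (h : A.ncoef 0 u w = l • w) : A.ncoef 1 u w = 0 := by
  have h1 := A.ncoef_zero_ncoef 1 u u w
  obtain ⟨c, hc⟩ := W.gr_le_span_vac (n := 0) le_rfl (by simpa using W.ncoef_mem 1 1 1 u hu w hw)
  rw [W.ncoef_zero_self hu, h, map_zero, LinearMap.zero_apply, add_zero, map_smul, ← hc, map_smul,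
    A.ncoef_vac_zero 0 le_rfl, smul_zero, hc] at h1
  simpa [hl] using h1.symm

/-- A conformal vector of strong CFT type without component in `V_1` is equivalent to `ω`. -/
theorem exists_aut_of_eq_add_T (hs : A.IsSimple) {a u : V} {c : K}
    (ha : a = W.ω + c • A.vac + A.T u) (haa : A.ncoef 1 a a = (2 : K) • a)
    (hspan : ⨆ n, A.eig a n = ⊤) (hL1 : ∀ v ∈ A.eig a 1, A.ncoef 2 a v = 0) :
    ∃ f : V → V, A.IsVAAut f ∧ f W.ω = a := by
  obtain ⟨u₁, hu₁⟩ : ∃ u₁, u₁ = W.proj 1 u := ⟨_, rfl⟩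
  have hu₁m : u₁ ∈ W.gr 1 := hu₁ ▸ W.proj_mem 1 u
  obtain ⟨r, hr⟩ : ∃ r, r = u - W.proj 0 u - W.proj 1 u := ⟨_, rfl⟩
  have hrm : r ∈ W.filtration 2 := by
    have h1 := W.sub_proj_mem_filtration (W.mem_filtration_zero u)
    have h2 := W.sub_proj_mem_filtration h1
    rw [map_sub, W.proj_of_mem_ne (W.proj_mem 0 u) (by norm_num), sub_zero] at h2
    rw [hr]
    exact h2
  have hTu : A.T u = A.T u₁ + A.T r := by
    obtain ⟨d, hd⟩ := W.gr_le_span_vac le_rfl (W.proj_mem 0 u)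
    rw [hr, map_sub, map_sub, ← hu₁, ← hd, map_smul, A.T_vac]
    simp
  have hmode : ∀ n : ℤ, n ≠ -1 → ∀ x, A.ncoef n a x = A.ncoef n W.ω x
      - (n : K) • A.ncoef (n - 1) u₁ x - (n : K) • A.ncoef (n - 1) r x := by
    intro n hn x
    rw [ha, hTu]
    simp only [map_add, map_smul, LinearMap.add_apply, LinearMap.smul_apply, A.vac_ncoef,
      if_neg hn, A.T_ncoef]
    simp
    abel
  have hproj : ∀ m, ∀ x ∈ W.filtration m,
      A.ncoef 1 a x - (m : K) • x + A.ncoef 0 u₁ (W.proj m x) ∈ W.filtration (m + 1) := by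
    intro m x hx
    have h1 : A.ncoef 1 W.ω x - (m : K) • x ∈ W.filtration (m + 1) := by
      rw [W.mem_filtration]
      intro i hi
      rw [map_sub, map_smul, W.proj_L0]
      rcases eq_or_ne i m with rfl | hne
      · exact sub_self _
      · rw [W.mem_filtration.mp hx i (by omega)]
        simp
    have h2 : A.ncoef 0 r x ∈ W.filtration (m + 1) := by
      have h := W.ncoef_mem_filtration 0 hrm hx
      rwa [show 2 + m - 0 - 1 = m + 1 by ring] at h
    have h3 : A.ncoef 0 u₁ (x - W.proj m x) ∈ W.filtration (m + 1) := by
      have h := W.ncoef_mem_filtration 0 (W.gr_le_filtration le_rfl hu₁m)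
        (W.sub_proj_mem_filtration hx)
      rwa [show 1 + (m + 1) - 0 - 1 = m + 1 by ring] at h
    have h4 := sub_mem (sub_mem h1 h2) h3
    convert h4 using 1
    rw [hmode 1 (by norm_num), map_sub]
    simp
    abel
  have hinv : ∀ x ∈ W.filtration 1, A.ncoef 1 a x ∈ W.filtration 1 := by
    intro x hx
    have h1 := W.filtration_anti (show (1 : ℤ) ≤ 1 + 1 by norm_num) (hproj 1 x hx)
    have h2 : A.ncoef 0 u₁ (W.proj 1 x) ∈ W.filtration 1 :=
      W.gr_le_filtration le_rfl (by simpa using W.ncoef_mem 1 1 0 u₁ hu₁m _ (W.proj_mem 1 x))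
    rw [Submodule.add_mem_iff_left _ h2, Submodule.sub_mem_iff_left _ (Submodule.smul_mem _ _ hx)]
      at h1
    exact h1
  have horth : ∀ z, ∀ k : ℤ, z ∈ W.filtration 1 → z ∈ A.eig a k →
      A.ncoef 1 u₁ (W.proj 1 z) = 0 := by
    intro z k hz hk
    rcases eq_or_ne k 1 with rfl | hne
    · have h1 := hL1 z hk
      rw [hmode 2 (by norm_num)] at h1
      have h2 := congrArg (W.proj 0) h1
      have hL : W.proj 0 (A.ncoef 2 W.ω z) = 0 := by
        have h := W.proj_ncoef_of_mem_filtration 2 (W.gr_le_filtration le_rfl W.ω_mem) hz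
        norm_num at h
        rw [h, W.proj_of_mem W.ω_mem, W.L1_V1 _ (W.proj_mem 1 z)]
      have hU : W.proj 0 (A.ncoef 1 u₁ z) = A.ncoef 1 u₁ (W.proj 1 z) := by
        have h := W.proj_ncoef_of_mem_filtration 1 (W.gr_le_filtration le_rfl hu₁m) hz
        norm_num at h
        rw [h, W.proj_of_mem hu₁m]
      have hR : W.proj 0 (A.ncoef 1 r z) = 0 := by
        have h := W.ncoef_mem_filtration 1 hrm hz
        exact W.mem_filtration.mp h 0 (by norm_num)
      rw [map_sub, map_sub, map_smul, map_smul, show (2 : ℤ) - 1 = 1 by norm_num, hL, hU, hR] at h2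
      simpa using h2
    · have hmem : A.ncoef 0 u₁ (W.proj 1 z) ∈ W.gr 1 := by
        simpa using W.ncoef_mem 1 1 0 u₁ hu₁m _ (W.proj_mem 1 z)
      have h1 := (W.mem_filtration_succ.mp (hproj 1 z hz)).2
      rw [A.mem_eig.mp hk, ← sub_smul, map_add, map_smul, W.proj_of_mem hmem] at h1
      refine W.ncoef_one_eq_zero_of_eigenvector hu₁m (W.proj_mem 1 z) (l := 1 - (k : K)) ?_ ?_
      · rw [sub_ne_zero]
        exact_mod_cast hne.symm
      · rw [eq_neg_of_add_eq_zero_right h1, ← neg_smul]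
        simp
  have hu₁0 : u₁ = 0 := by
    refine W.eq_zero_of_orthogonal hs hu₁m fun w hw => ?_
    obtain ⟨s, z, hz, hws⟩ := A.exists_finset_sum_eig hspan w
    have hzF := LinearMap.mem_of_sum_eigenvectors_mem (A.ncoef 1 a) hinv s z
      (fun k => A.mem_eig.mp (hz k)) (hws ▸ W.gr_le_filtration le_rfl hw)
    rw [← W.proj_of_mem hw, hws, map_sum, map_sum]
    exact Finset.sum_eq_zero fun k hk => horth _ k (hzF k hk) (hz k)
  have hE : ∀ m, ∀ x ∈ W.filtration m, A.ncoef 1 a x - (m : K) • x ∈ W.filtration (m + 1) := by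
    intro m x hx
    simpa [hu₁0] using hproj m x hx
  have h0 : A.ncoef 0 a = A.T := by
    ext x
    rw [hmode 0 (by norm_num), W.Lneg1_eq_T]
    simp
  obtain ⟨g, hg, hgp⟩ := W.exists_aut_leading_term h0 hspan hE
  obtain ⟨f, hf, hfg⟩ := hg.exists_inverse
  refine ⟨f, hf, ?_⟩
  have hga : g a = W.ω := by
    rw [hgp 2 a (by rw [A.mem_eig, haa]; simp), ha, map_add, map_add, W.proj_of_mem W.ω_mem,
      map_smul, W.proj_of_mem_ne W.vac_mem (by norm_num)]
    have h := W.proj_map_of_homogeneous A.T (fun i x hx => W.T_mem hx) 1 u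
    rw [← hu₁, hu₁0, map_zero] at h
    norm_num at h
    simp [h]
  rw [← hga, hfg]

end PositivePart

end VOAsCFT

section Exponential

variable {K V U : Type*} [Field K] [AddCommGroup V] [Module K V] [AddCommGroup U] [Module K U]

theorem Module.End.pow_apply_eq_zero_of_le {D : V →ₗ[K] V} {N n : ℕ} {x : V}
    (h : (D ^ N) x = 0) (hn : N ≤ n) : (D ^ n) x = 0 := by
  obtain ⟨k, rfl⟩ := Nat.exists_eq_add_of_le' hn
  rw [pow_add, Module.End.mul_apply, h, map_zero]

theorem expOp_eq_sum {D : V →ₗ[K] V} {N : ℕ} {x : V} (h : (D ^ N) x = 0) :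
    expOp D x = ∑ n ∈ Finset.range N, (Nat.factorial n : K)⁻¹ • (D ^ n) x := by
  refine finsum_eq_sum_of_support_subset _ fun n hn => ?_
  by_contra hmem
  have hlt : N ≤ n := by simpa using hmem
  refine hn ?_
  simp [Module.End.pow_apply_eq_zero_of_le h hlt]

theorem expOp_intertwine {D : V →ₗ[K] V} {Z : U →ₗ[K] U} (β : U →ₗ[K] V)
    (hβ : ∀ t, D (β t) = β (Z t)) {N : ℕ} {t : U} (h : (Z ^ N) t = 0) :
    expOp D (β t) = β (expOp Z t) := by
  have hpow : ∀ n, (D ^ n) (β t) = β ((Z ^ n) t) := by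
    intro n
    induction n with
    | zero => simp
    | succ n ih => rw [pow_succ', pow_succ', Module.End.mul_apply, ih, hβ, Module.End.mul_apply]
  rw [expOp_eq_sum h, expOp_eq_sum (by rw [hpow, h, map_zero]), map_sum]
  exact Finset.sum_congr rfl fun n _ => by rw [hpow, map_smul]

theorem sum_range_sum_range_eq_sum_antidiagonal (F : ℕ → ℕ → V) (N : ℕ)
    (hF : ∀ i j, N ≤ i ∨ N ≤ j → F i j = 0) :
    ∑ i ∈ Finset.range N, ∑ j ∈ Finset.range N, F i j
      = ∑ n ∈ Finset.range (2 * N), ∑ p ∈ Finset.HasAntidiagonal.antidiagonal n, F p.1 p.2 := by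
  rw [← Finset.sum_product', ← Finset.sum_fiberwise_of_maps_to (g := fun p : ℕ × ℕ => p.1 + p.2)
    (t := Finset.range (2 * N))]
  · refine Finset.sum_congr rfl fun n _ => Finset.sum_subset (fun p hp => ?_) fun p hp hp' => ?_
    · simpa using (Finset.mem_filter.mp hp).2
    · refine hF _ _ ?_
      by_contra! hlt
      exact hp' (by simpa [hlt] using hp)
  · intro p hp
    simp only [Finset.mem_product, Finset.mem_range] at hp ⊢
    omega

variable [CharZero K]

theorem expOp_add_of_commute {X Y : V →ₗ[K] V} (hc : Commute X Y) {N : ℕ} {x : V}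
    (hX : (X ^ N) x = 0) (hY : (Y ^ N) x = 0) :
    ((X + Y) ^ (2 * N)) x = 0 ∧ expOp (X + Y) x = ∑ i ∈ Finset.range N, ∑ j ∈ Finset.range N,
      ((Nat.factorial i : K)⁻¹ * (Nat.factorial j : K)⁻¹) • (X ^ i) ((Y ^ j) x) := by
  have hz : ∀ i j, N ≤ i ∨ N ≤ j → (X ^ i) ((Y ^ j) x) = 0 := by
    rintro i j (h | h)
    · rw [← Module.End.mul_apply, (hc.pow_pow i j).eq, Module.End.mul_apply,
        Module.End.pow_apply_eq_zero_of_le hX h, map_zero]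
    · rw [Module.End.pow_apply_eq_zero_of_le hY h, map_zero]
  have hpow : ∀ n, ((X + Y) ^ n) x
      = ∑ p ∈ Finset.HasAntidiagonal.antidiagonal n, n.choose p.1 • (X ^ p.1) ((Y ^ p.2) x) := by
    intro n
    rw [hc.add_pow', LinearMap.sum_apply]
    rfl
  have h0 : ((X + Y) ^ (2 * N)) x = 0 := by
    rw [hpow]
    refine Finset.sum_eq_zero fun p hp => ?_
    rw [Finset.HasAntidiagonal.mem_antidiagonal] at hp
    rw [hz _ _ (by omega), smul_zero]
  refine ⟨h0, ?_⟩
  rw [expOp_eq_sum h0, sum_range_sum_range_eq_sum_antidiagonal _ N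
    fun i j h => by rw [hz i j h, smul_zero]]
  refine Finset.sum_congr rfl fun n _ => ?_
  rw [hpow, Finset.smul_sum]
  refine Finset.sum_congr rfl fun p hp => ?_
  rw [Finset.HasAntidiagonal.mem_antidiagonal] at hp
  rw [← Nat.cast_smul_eq_nsmul K, smul_smul]
  congr 1
  have h1 : (Nat.factorial p.1 : K) ≠ 0 := by exact_mod_cast p.1.factorial_ne_zero
  have h2 : (Nat.factorial p.2 : K) ≠ 0 := by exact_mod_cast p.2.factorial_ne_zero
  have h3 : (Nat.factorial n : K) ≠ 0 := by exact_mod_cast n.factorial_ne_zero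
  have h4 : (n.choose p.1 : K) * Nat.factorial p.1 * Nat.factorial p.2 = Nat.factorial n := by
    rw [← hp]
    rw [Nat.choose_symm_add]
    exact_mod_cast Nat.add_choose_mul_factorial_mul_factorial p.1 p.2
  field_simp
  linear_combination h4

theorem expOp_expOp_neg {D : V →ₗ[K] V} {N : ℕ} {x : V} (h : (D ^ N) x = 0) :
    expOp D (expOp (-D) x) = x := by
  have hn : ((-D) ^ N) x = 0 := by
    rw [neg_pow, Module.End.mul_apply, h, map_zero]
  have hc : Commute D (-D) := (Commute.refl D).neg_right
  have h1 := (expOp_add_of_commute hc h hn).2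
  have h2 : (D ^ N) (expOp (-D) x) = 0 := by
    rw [expOp_eq_sum hn, map_sum]
    refine Finset.sum_eq_zero fun j _ => ?_
    rw [map_smul, ← Module.End.mul_apply, (hc.pow_pow N j).eq, Module.End.mul_apply, h, map_zero,
      smul_zero]
  rw [add_neg_cancel, expOp_eq_sum (N := 1) (by simp)] at h1
  rw [expOp_eq_sum h2, expOp_eq_sum hn]
  simp only [map_sum, map_smul, Finset.smul_sum, smul_smul]
  rw [← h1]
  simp

/-- The exponential of a locally nilpotent derivation is an automorphism. -/
theorem VA.isVAAut_expOp (A : VA K V) (D : V →ₗ[K] V) (hnil : ∀ x, ∃ N, (D ^ N) x = 0)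
    (hder : ∀ n x y, D (A.ncoef n x y) = A.ncoef n (D x) y + A.ncoef n x (D y)) :
    A.IsVAAut (expOp D) := by
  have hvac : D A.vac = 0 := by
    have h := hder (-1) A.vac A.vac
    simpa [A.ncoef_vac, A.vac_ncoef] using h
  refine ⟨⟨fun x y => ?_, fun c x => ?_, fun n x y => ?_, ?_⟩, ?_⟩
  · obtain ⟨N, hN⟩ := hnil x
    obtain ⟨M, hM⟩ := hnil y
    have hx := Module.End.pow_apply_eq_zero_of_le hN (le_max_left N M)
    have hy := Module.End.pow_apply_eq_zero_of_le hM (le_max_right N M)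
    rw [expOp_eq_sum hx, expOp_eq_sum hy, expOp_eq_sum (by rw [map_add, hx, hy, add_zero]),
      ← Finset.sum_add_distrib]
    simp only [map_add, smul_add]
  · obtain ⟨N, hN⟩ := hnil x
    exact expOp_intertwine (D := D) (Z := D) (c • LinearMap.id) (by simp) hN
  · obtain ⟨N₁, hN₁⟩ := hnil x
    obtain ⟨N₂, hN₂⟩ := hnil y
    obtain ⟨N, hx, hy⟩ : ∃ N, (D ^ N) x = 0 ∧ (D ^ N) y = 0 :=
      ⟨_, Module.End.pow_apply_eq_zero_of_le hN₁ (le_max_left N₁ N₂),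
        Module.End.pow_apply_eq_zero_of_le hN₂ (le_max_right N₁ N₂)⟩
    let X : Module.End K (TensorProduct K V V) := LinearMap.rTensor V D
    let Y : Module.End K (TensorProduct K V V) := LinearMap.lTensor V D
    have hc : Commute X Y := by
      refine TensorProduct.ext' fun v w => ?_
      simp [X, Y]
    have hXp : ∀ i, X ^ i = LinearMap.rTensor V (D ^ i) := fun i => LinearMap.rTensor_pow D i
    have hYp : ∀ i, Y ^ i = LinearMap.lTensor V (D ^ i) := fun i => LinearMap.lTensor_pow D i
    obtain ⟨h1, h2⟩ := expOp_add_of_commute hc (N := N) (x := TensorProduct.tmul K x y)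
      (by rw [hXp, LinearMap.rTensor_tmul, hx, TensorProduct.zero_tmul])
      (by rw [hYp, LinearMap.lTensor_tmul, hy, TensorProduct.tmul_zero])
    have h3 := expOp_intertwine (D := D) (Z := X + Y) (TensorProduct.lift (A.ncoef n))
      (fun t => by
        induction t with
        | zero => simp
        | tmul v w => simp [X, Y, hder]
        | add s t hs ht => simp only [map_add, hs, ht]) h1
    rw [TensorProduct.lift.tmul, h2] at h3
    rw [h3, expOp_eq_sum hx, expOp_eq_sum hy]
    simp only [map_sum, map_smul, LinearMap.sum_apply, LinearMap.smul_apply, hXp, hYp,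
      LinearMap.rTensor_tmul, LinearMap.lTensor_tmul, TensorProduct.lift.tmul, Finset.smul_sum,
      smul_smul]
    rw [Finset.sum_comm]
    simp only [mul_comm]
  · rw [expOp_eq_sum (N := 1) (by simpa using hvac)]
    simp
  · refine Function.bijective_iff_has_inverse.mpr ⟨expOp (-D), fun x => ?_, fun x => ?_⟩
    · obtain ⟨N, hN⟩ := hnil x
      have h := expOp_expOp_neg (D := -D) (N := N) (x := x)
        (by rw [neg_pow, Module.End.mul_apply, hN, map_zero])
      rwa [neg_neg] at h
    · obtain ⟨N, hN⟩ := hnil x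
      exact expOp_expOp_neg hN

end Exponential

namespace VOAsCFT

section NegativePart

variable {K V : Type*} [Field K] [CharZero K] [AddCommGroup V] [Module K V] {A : VA K V}
  (W : VOAsCFT A)

theorem exists_aut_map_omega_eq_add {v : V} (hv : v ∈ W.gr 1) (hv0 : A.ncoef 0 v = 0) :
    ∃ f : V → V, A.IsVAAut f ∧ ∃ c : K, f W.ω = W.ω + v + c • A.vac := by
  have hdeg : ∀ (N : ℕ) (i : ℤ), ∀ x ∈ W.gr i, ((A.ncoef 1 v) ^ N) x ∈ W.gr (i - N) := by
    intro N i x hx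
    induction N with
    | zero => simpa using hx
    | succ N ih =>
      rw [pow_succ', Module.End.mul_apply]
      have h := W.ncoef_mem 1 _ 1 v hv _ ih
      push_cast
      rwa [show 1 + (i - (N : ℤ)) - 1 - 1 = i - (N + 1) by ring] at h
  have hnil : ∀ x, ∃ N, ((A.ncoef 1 v) ^ N) x = 0 := by
    intro x
    obtain ⟨s, hs⟩ := W.exists_eq_sum_proj x
    refine ⟨(s.sup Int.toNat) + 1, ?_⟩
    rw [hs, map_sum]
    refine Finset.sum_eq_zero fun i hi => ?_
    have hle : i.toNat ≤ s.sup Int.toNat := Finset.le_sup hi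
    exact W.eq_zero_of_mem_gr_neg (by push_cast; omega) (hdeg _ i _ (W.proj_mem i x))
  have hder : ∀ n x y, A.ncoef 1 v (A.ncoef n x y)
      = A.ncoef n (A.ncoef 1 v x) y + A.ncoef n x (A.ncoef 1 v y) := by
    intro n x y
    rw [A.ncoef_one_ncoef, hv0]
    simp [add_comm]
  refine ⟨_, A.isVAAut_expOp (A.ncoef 1 v) hnil hder, ?_⟩
  have hω : A.ncoef 1 v W.ω = v := by
    rw [A.skew_symmetry, finsum_eq_single _ 0]
    · simp [A.ncoef_vac, W.L0_grading 1 v hv]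
    · intro i hi
      rcases eq_or_ne i 1 with rfl | hi1
      · simp [W.L1_V1 v hv]
      · rw [W.eq_zero_of_mem_gr_neg _ (W.ncoef_mem 2 1 (1 + i) _ W.ω_mem v hv), map_zero,
          LinearMap.zero_apply, smul_zero]
        omega
  obtain ⟨c, hc⟩ := W.gr_le_span_vac (n := 0) le_rfl (by simpa using W.ncoef_mem 1 1 1 v hv v hv)
  refine ⟨2⁻¹ * c, ?_⟩
  have hv2 : A.ncoef 1 v v = c • A.vac := hc.symm
  have hvac : A.ncoef 1 v A.vac = 0 := A.ncoef_vac_zero 1 zero_le_one v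
  rw [expOp_eq_sum (N := 3) (by simp [pow_succ, hω, hv2, hvac])]
  simp [Finset.sum_range_succ, pow_succ, hω, hv2, smul_smul]

end NegativePart

end VOAsCFT

/-- Theorem `main`: if `(V, ω)` is a simple VOA of strong CFT type,
then `Aut V` acts transitively on `CV_sCFT`: every conformal vector of strong CFT type
is the image of `ω` under some vertex algebra automorphism. -/
theorem aut_transitive_on_CVsCFT {K V : Type*} [RCLike K]
    [AddCommGroup V] [Module K V]
    (A : VA K V) (W : VOAsCFT A) (hs : A.IsSimple)
    (a : V) (ha : A.IsConformalSCFT a) :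
    ∃ f : V → V, A.IsVAAut f ∧ f W.ω = a := by
  obtain ⟨⟨⟨haa, -, -, -, hT, hint⟩, -⟩, hL1⟩ := ha
  have hspan := hint.submodule_iSup_eq_top
  have hb : A.ncoef 0 (a - W.ω) = 0 := by rw [map_sub, hT, W.Lneg1_eq_T, sub_self]
  obtain ⟨v, hv, hv0, c, u, hu⟩ := W.exists_eq_add_T_of_ncoef_zero_eq_zero hb
  obtain ⟨f, hf, d, hfω⟩ := W.exists_aut_map_omega_eq_add hv hv0
  obtain ⟨u', rfl⟩ := hf.2.surjective u
  obtain ⟨a', rfl⟩ := hf.2.surjective a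
  have ha' : a' = W.ω + (c - d) • A.vac + A.T u' := by
    apply hf.2.injective
    rw [hf.1.map_add, hf.1.map_add, hf.1.map_smul, hf.1.map_vac, hf.1.map_T, hfω,
      sub_eq_iff_eq_add.mp hu]
    module
  have hmem : ∀ n x, f x ∈ A.eig (f a') n ↔ x ∈ A.eig a' n := by
    intro n x
    rw [A.mem_eig, A.mem_eig, ← hf.1.map_ncoef, ← hf.1.map_smul, hf.2.injective.eq_iff]
  have hspan' : ⨆ n, A.eig a' n = ⊤ := by
    let F : V →ₗ[K] V := ⟨⟨f, hf.1.map_add⟩, hf.1.map_smul⟩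
    have hle : ⨆ n, A.eig (f a') n ≤ (⨆ n, A.eig a' n).map F := by
      refine iSup_le fun n y hy => ?_
      obtain ⟨x, rfl⟩ := hf.2.surjective y
      exact ⟨x, Submodule.mem_iSup_of_mem n ((hmem n x).mp hy), rfl⟩
    rw [eq_top_iff]
    intro x _
    obtain ⟨z, hz, hzx⟩ := hle (hspan ▸ Submodule.mem_top : f x ∈ _)
    rwa [← hf.2.injective hzx]
  have hf0 : f 0 = 0 := by simpa using hf.1.map_smul 0 0
  obtain ⟨g, hg, hgω⟩ := W.exists_aut_of_eq_add_T hs ha'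
    (hf.2.injective (by rw [hf.1.map_ncoef, haa, hf.1.map_smul])) hspan'
    (fun w hw => hf.2.injective (by rw [hf.1.map_ncoef, hL1 _ ((hmem 1 w).mpr hw), hf0]))
  exact ⟨f ∘ g, hf.comp hg, congrArg f hgω⟩
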